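/- Let k ≥ 1 and let G be an edge-colored graph with average color degree d̂(G) ≥ 2k − 1, not isomorphic (as an edge-colored graph) to K̃₄, which contains no rainbow matching of size k. Then G contains a cycle of length 3 and a cycle of length 4. -/

import Mathlib

/-- The color degree of a vertex `v`: the number of distinct colors appearing
on edges of `G` incident to `v`. -/
noncomputable def colorDegree {V : Type*} (G : SimpleGraph V) (c : Sym2 V → ℕ) (v : V) : ℕ :=
  (c '' {e : Sym2 V | e ∈ G.edgeSet ∧ v ∈ e}).ncard

/-- `M` is a rainbow matching in the edge-colored graph `(G, c)`:
a set of edges of `G`, pairwise vertex-disjoint, with pairwise distinct colors. -/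
def IsRainbowMatching {V : Type*} (G : SimpleGraph V) (c : Sym2 V → ℕ)
    (M : Finset (Sym2 V)) : Prop :=
  ↑M ⊆ G.edgeSet ∧
  (∀ e ∈ M, ∀ f ∈ M, e ≠ f → ∀ v : V, v ∈ e → v ∉ f) ∧
  Set.InjOn c ↑M

/-- The canonical proper 3-edge-coloring of `K₄` in which every color class is a
perfect matching: the edge `{i, j}` gets color `i xor j`. -/
def k4Coloring : Sym2 (Fin 4) → ℕ :=
  Sym2.lift ⟨fun i j => i.val ^^^ j.val, fun i j => Nat.xor_comm i.val j.val⟩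

/-- `(G, c)` is isomorphic, as an edge-colored graph, to `K̃₄`: there is a bijection of the
vertex set with `Fin 4` under which `G` is complete and two edges of `G` have equal colors
iff the corresponding edges of `K̃₄` have equal colors. -/
def IsK4Tilde {V : Type*} (G : SimpleGraph V) (c : Sym2 V → ℕ) : Prop :=
  ∃ f : V ≃ Fin 4,
    (∀ u v : V, G.Adj u v ↔ u ≠ v) ∧
    (∀ u v w x : V, G.Adj u v → G.Adj w x →
      (c s(u, v) = c s(w, x) ↔ k4Coloring s(f u, f v) = k4Coloring s(f w, f x)))

section Helpers
open Classical

variable {V : Type*} [Fintype V]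

/-- Color degree inside the vertex set `U`. -/
noncomputable def cdIn (G : SimpleGraph V) (c : Sym2 V → ℕ) (U : Finset V) (v : V) : ℕ :=
  ((U.filter (fun w => G.Adj v w)).image (fun w => c s(v, w))).card

/-- There is a rainbow matching of size `k` inside `U`. -/
def HasRM (G : SimpleGraph V) (c : Sym2 V → ℕ) (U : Finset V) (k : ℕ) : Prop :=
  ∃ M : Finset (Sym2 V), IsRainbowMatching G c M ∧ M.card = k ∧ ∀ e ∈ M, ∀ v ∈ e, v ∈ U

/-- Vertices covered by `M`. -/
noncomputable def cov (M : Finset (Sym2 V)) : Finset V := M.biUnion (fun e => e.toFinset)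

lemma mem_cov (M : Finset (Sym2 V)) (v : V) : v ∈ cov M ↔ ∃ e ∈ M, v ∈ e := by
  simp [cov]

lemma card_cov (G : SimpleGraph V) (c : Sym2 V → ℕ) (M : Finset (Sym2 V))
    (hM : IsRainbowMatching G c M) : (cov M).card = 2 * M.card := by
  unfold cov
  rw [Finset.card_biUnion]
  · rw [Finset.sum_const_nat (m := 2)]
    · ring
    · intro e he
      exact Sym2.card_toFinset_of_not_isDiag e (G.not_isDiag_of_mem_edgeSet (hM.1 he))
  · intro e he f hf hef
    rw [Function.onFun, Finset.disjoint_left]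
    intro v hv hv2
    exact hM.2.1 e he f hf hef v (by simpa using hv) (by simpa using hv2)

lemma hasRM_extend (G : SimpleGraph V) (c : Sym2 V → ℕ) (U : Finset V) (M : Finset (Sym2 V))
    (hM : IsRainbowMatching G c M) (hU : ∀ e ∈ M, ∀ v ∈ e, v ∈ U) (x y : V)
    (hx : x ∈ U) (hy : y ∈ U) (hxy : G.Adj x y) (hxS : x ∉ cov M) (hyS : y ∉ cov M)
    (hc : c s(x, y) ∉ M.image c) : HasRM G c U (M.card + 1) := by
  have hn : s(x, y) ∉ M := fun h => hc (Finset.mem_image_of_mem c h)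
  rw [mem_cov] at hxS hyS
  push Not at hxS hyS
  refine ⟨insert s(x, y) M, ⟨?_, ?_, ?_⟩, Finset.card_insert_of_notMem hn, ?_⟩
  · intro e he
    simp only [Finset.coe_insert, Set.mem_insert_iff, Finset.mem_coe] at he
    rcases he with rfl | he
    · exact hxy
    · exact hM.1 he
  · intro e he f hf hef v hve hvf
    rw [Finset.mem_insert] at he hf
    rcases he with rfl | he <;> rcases hf with rfl | hf
    · exact hef rfl
    · rw [Sym2.mem_iff] at hve
      rcases hve with rfl | rfl
      · exact hxS f hf hvf
      · exact hyS f hf hvf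
    · rw [Sym2.mem_iff] at hvf
      rcases hvf with rfl | rfl
      · exact hxS e he hve
      · exact hyS e he hve
    · exact hM.2.1 e he f hf hef v hve hvf
  · rw [Finset.coe_insert, Set.injOn_insert (by simpa using hn)]
    refine ⟨hM.2.2, ?_⟩
    intro h
    apply hc
    simpa using h
  · intro e he v hv
    rw [Finset.mem_insert] at he
    rcases he with rfl | he
    · rw [Sym2.mem_iff] at hv
      rcases hv with rfl | rfl <;> assumption
    · exact hU e he v hv

/-- If a matching cannot be extended, uncovered vertices have few colors. -/
lemma cdIn_le_of_noext (G : SimpleGraph V) (c : Sym2 V → ℕ) (U : Finset V) (M : Finset (Sym2 V))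
    (hM : IsRainbowMatching G c M) (hU : ∀ e ∈ M, ∀ v ∈ e, v ∈ U)
    (hno : ¬ HasRM G c U (M.card + 1)) (w : V) (hw : w ∈ U) (hwS : w ∉ cov M) :
    cdIn G c U w ≤ M.card + ((cov M).filter (fun x => G.Adj w x)).card := by
  unfold cdIn
  have hsub : (U.filter (fun x => G.Adj w x)).image (fun x => c s(w, x)) ⊆
      M.image c ∪ ((cov M).filter (fun x => G.Adj w x)).image (fun x => c s(w, x)) := by
    intro a ha
    rw [Finset.mem_image] at ha
    obtain ⟨x, hx, rfl⟩ := ha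
    rw [Finset.mem_filter] at hx
    rw [Finset.mem_union]
    by_contra hcon
    push Not at hcon
    apply hno
    refine hasRM_extend G c U M hM hU w x hw hx.1 hx.2 hwS ?_ hcon.1
    intro hxS
    exact hcon.2 (Finset.mem_image.2 ⟨x, Finset.mem_filter.2 ⟨hxS, hx.2⟩, rfl⟩)
  refine (Finset.card_le_card hsub).trans ((Finset.card_union_le _ _).trans ?_)
  exact Nat.add_le_add Finset.card_image_le Finset.card_image_le

lemma cdIn_le_erase (G : SimpleGraph V) (c : Sym2 V → ℕ) (U : Finset V) (v w : V) :
    cdIn G c U w ≤ cdIn G c (U.erase v) w + 1 := by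
  unfold cdIn
  have hsub : (U.filter (fun x => G.Adj w x)).image (fun x => c s(w, x)) ⊆
      insert (c s(w, v)) (((U.erase v).filter (fun x => G.Adj w x)).image (fun x => c s(w, x))) := by
    intro a ha
    rw [Finset.mem_image] at ha
    obtain ⟨x, hx, rfl⟩ := ha
    rw [Finset.mem_filter] at hx
    by_cases h : x = v
    · subst h
      exact Finset.mem_insert_self _ _
    · exact Finset.mem_insert_of_mem (Finset.mem_image.2
        ⟨x, Finset.mem_filter.2 ⟨Finset.mem_erase.2 ⟨h, hx.1⟩, hx.2⟩, rfl⟩)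
  exact (Finset.card_le_card hsub).trans (Finset.card_insert_le _ _)

lemma cdIn_le_card_erase (G : SimpleGraph V) (c : Sym2 V → ℕ) (U : Finset V) (v : V) :
    cdIn G c U v ≤ (U.erase v).card := by
  refine Finset.card_image_le.trans (Finset.card_le_card ?_)
  intro x hx
  rw [Finset.mem_filter] at hx
  exact Finset.mem_erase.2 ⟨hx.2.ne', hx.1⟩

lemma avg_erase (G : SimpleGraph V) (c : Sym2 V → ℕ) (U : Finset V) (k : ℕ) (v : V) (hv : v ∈ U)
    (h : 2 * (k + 1) * U.card ≤ ∑ w ∈ U, cdIn G c U w + U.card) :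
    2 * k * (U.erase v).card ≤
      ∑ w ∈ U.erase v, cdIn G c (U.erase v) w + (U.erase v).card := by
  have h1 := Finset.add_sum_erase U (cdIn G c U) hv
  have h2 : ∑ w ∈ U.erase v, cdIn G c U w ≤
      ∑ w ∈ U.erase v, (cdIn G c (U.erase v) w + 1) :=
    Finset.sum_le_sum (fun w _ => cdIn_le_erase G c U v w)
  rw [Finset.sum_add_distrib] at h2
  simp only [Finset.sum_const, smul_eq_mul, mul_one] at h2
  have h3 := cdIn_le_card_erase G c U v
  have h4 := Finset.card_erase_add_one hv
  rw [← h4] at h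
  nlinarith

lemma exists_large (G : SimpleGraph V) (c : Sym2 V → ℕ) (U : Finset V) (k : ℕ)
    (hne : U.Nonempty)
    (h : 2 * (k + 1) * U.card ≤ ∑ w ∈ U, cdIn G c U w + U.card) :
    ∃ v ∈ U, 2 * k + 1 ≤ cdIn G c U v := by
  by_contra hcon
  push Not at hcon
  have := Finset.sum_lt_sum_of_nonempty hne hcon
  simp only [Finset.sum_const, smul_eq_mul] at this
  nlinarith

lemma triangle_free_case (G : SimpleGraph V) (c : Sym2 V → ℕ)
    (hG : ¬ ∃ a b d : V, G.Adj a b ∧ G.Adj b d ∧ G.Adj d a) (k : ℕ) :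
    ∀ U : Finset V, (k = 0 ∨ U.Nonempty) →
      2 * k * U.card ≤ ∑ w ∈ U, cdIn G c U w + U.card → HasRM G c U k := by
  induction k with
  | zero =>
    intro U _ _
    exact ⟨∅, ⟨by simp, by simp, by simp⟩, rfl, by simp⟩
  | succ k ih =>
    intro U hne h
    have hne : U.Nonempty := by simpa using hne
    obtain ⟨v, hv, hvd⟩ := exists_large G c U k hne h
    have hne' : k = 0 ∨ (U.erase v).Nonempty := by
      have := cdIn_le_card_erase G c U v
      right
      rw [← Finset.card_pos]
      omega
    obtain ⟨M, hM, hMk, hMU⟩ := ih (U.erase v) hne' (avg_erase G c U k v hv h)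
    by_contra hno
    have hvS : v ∉ cov M := by
      rw [mem_cov]
      rintro ⟨e, he, hve⟩
      exact Finset.notMem_erase v U (hMU e he v hve)
    have h1 := cdIn_le_of_noext G c U M hM
      (fun e he v hve => Finset.mem_of_mem_erase (hMU e he v hve)) (by rwa [hMk]) v hv hvS
    have h2 : ((cov M).filter (fun x => G.Adj v x)).card ≤ M.card * 1 := by
      unfold cov
      rw [Finset.filter_biUnion]
      refine Finset.card_biUnion_le_card_mul _ _ _ ?_
      intro e he
      rw [Finset.card_le_one]
      intro a ha b hb
      rw [Finset.mem_filter, Sym2.mem_toFinset] at ha hb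
      by_contra hab
      have hE := hM.1 he
      rw [((Sym2.mem_and_mem_iff hab).1 ⟨ha.1, hb.1⟩)] at hE
      exact hG ⟨v, a, b, ha.2, hE, hb.2.symm⟩
    omega

lemma cherry_count (G : SimpleGraph V)
    (hG : ¬ ∃ a b d e : V, a ≠ d ∧ b ≠ e ∧ G.Adj a b ∧ G.Adj b d ∧ G.Adj d e ∧ G.Adj e a)
    (W S : Finset V) :
    ∑ w ∈ W, ((S.filter (fun x => G.Adj w x)).card * (S.filter (fun x => G.Adj w x)).card
      - (S.filter (fun x => G.Adj w x)).card) ≤ S.card * S.card - S.card := by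
  simp only [← Finset.offDiag_card]
  rw [← Finset.card_biUnion]
  · apply Finset.card_le_card
    intro p hp
    simp only [Finset.mem_biUnion, Finset.mem_offDiag, Finset.mem_filter] at hp ⊢
    obtain ⟨w, _, h1, h2, h3⟩ := hp
    exact ⟨h1.1, h2.1, h3⟩
  · intro w _ w' _ hww
    rw [Function.onFun, Finset.disjoint_left]
    rintro ⟨a, b⟩ h1 h2
    simp only [Finset.mem_offDiag, Finset.mem_filter] at h1 h2
    exact hG ⟨w, a, w', b, hww, h1.2.2, h1.1.2, h2.1.2.symm, h2.2.1.2, h1.2.1.2.symm⟩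

lemma C4_free_case (G : SimpleGraph V) (c : Sym2 V → ℕ)
    (hG : ¬ ∃ a b d e : V, a ≠ d ∧ b ≠ e ∧ G.Adj a b ∧ G.Adj b d ∧ G.Adj d e ∧ G.Adj e a)
    (k : ℕ) :
    ∀ U : Finset V, (k = 0 ∨ U.Nonempty) →
      2 * k * U.card ≤ ∑ w ∈ U, cdIn G c U w + U.card → HasRM G c U k := by
  induction k with
  | zero =>
    intro U _ _
    exact ⟨∅, ⟨by simp, by simp, by simp⟩, rfl, by simp⟩
  | succ k ih =>
    intro U hne h
    have hne : U.Nonempty := by simpa using hne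
    obtain ⟨v0, hv0, hvd⟩ := exists_large G c U k hne h
    have hcard : 2 ≤ U.card := by
      have := cdIn_le_card_erase G c U v0
      have := Finset.card_erase_add_one hv0
      omega
    have key : ∀ v ∈ U, ∃ M : Finset (Sym2 V), IsRainbowMatching G c M ∧ M.card = k ∧
        (∀ e ∈ M, ∀ v ∈ e, v ∈ U) ∧ v ∉ cov M := by
      intro v hv
      have hne' : (U.erase v).Nonempty := by
        rw [← Finset.card_pos]
        have := Finset.card_erase_add_one hv
        omega
      obtain ⟨M, hM, hMk, hMU⟩ := ih (U.erase v) (Or.inr hne') (avg_erase G c U k v hv h)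
      refine ⟨M, hM, hMk, fun e he v hve => Finset.mem_of_mem_erase (hMU e he v hve), ?_⟩
      rw [mem_cov]
      rintro ⟨e, he, hve⟩
      exact Finset.notMem_erase v U (hMU e he v hve)
    by_contra hno
    have hmax : ∀ v ∈ U, cdIn G c U v ≤ 3 * k := by
      intro v hv
      obtain ⟨M, hM, hMk, hMU, hvS⟩ := key v hv
      have h1 := cdIn_le_of_noext G c U M hM hMU (by rwa [hMk]) v hv hvS
      have h2 := Finset.card_filter_le (cov M) (fun x => G.Adj v x)
      have h3 := card_cov G c M hM
      omega
    obtain ⟨M, hM, hMk, hMU, -⟩ := key v0 hv0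
    have hScard := card_cov G c M hM
    have hSU : cov M ⊆ U := by
      intro x hx
      rw [mem_cov] at hx
      obtain ⟨e, he, hxe⟩ := hx
      exact hMU e he x hxe
    -- lower bound on the number of vertices
    have hA : (∑ w ∈ U, (2 * (2 * (k:ℤ) + 1) - 1) * (cdIn G c U w : ℤ)) ≤
        ∑ w ∈ U, ((((U.filter (fun x => G.Adj w x)).card * (U.filter (fun x => G.Adj w x)).card
      - (U.filter (fun x => G.Adj w x)).card : ℕ) : ℤ) + (2 * (k:ℤ) + 1) ^ 2) := by
      apply Finset.sum_le_sum
      intro w _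
      have h1 : cdIn G c U w ≤ (U.filter (fun x => G.Adj w x)).card := Finset.card_image_le
      rw [Nat.cast_sub (Nat.le_mul_self _)]
      push_cast
      zify at h1
      generalize ((U.filter (fun x => G.Adj w x)).card : ℤ) = d at *
      generalize (cdIn G c U w : ℤ) = e at *
      nlinarith [sq_nonneg (d - (2 * (k:ℤ) + 1)), mul_nonneg (Int.natCast_nonneg k) (sub_nonneg.2 h1)]
    rw [Finset.sum_add_distrib, ← Finset.mul_sum] at hA
    have hB := cherry_count G hG U U
    zify at hB
    rw [Nat.cast_sub (Nat.le_mul_self _)] at hB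
    have hC : (∑ w ∈ U \ cov M, 2 * (cdIn G c U w : ℤ)) ≤
        ∑ w ∈ U \ cov M, (((((cov M).filter (fun x => G.Adj w x)).card *
          ((cov M).filter (fun x => G.Adj w x)).card
      - ((cov M).filter (fun x => G.Adj w x)).card : ℕ) : ℤ) + (2 * k + 2)) := by
      apply Finset.sum_le_sum
      intro w hw
      rw [Finset.mem_sdiff] at hw
      have h1 := cdIn_le_of_noext G c U M hM hMU (by rwa [hMk]) w hw.1 hw.2
      rw [hMk] at h1
      rw [Nat.cast_sub (Nat.le_mul_self _)]
      zify at h1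
      push_cast
      generalize hd : ((cov M).filter (fun x => G.Adj w x)).card = d at *
      have : 0 ≤ ((d:ℤ) - 1) * ((d:ℤ) - 2) := by
        rcases d with _ | _ | d
        · norm_num
        · norm_num
        · push_cast
          have : (0:ℤ) ≤ d := Int.natCast_nonneg d
          nlinarith
      nlinarith
    rw [Finset.sum_add_distrib, ← Finset.mul_sum] at hC
    have hD := cherry_count G hG (U \ cov M) (cov M)
    zify at hD
    rw [Nat.cast_sub (Nat.le_mul_self _)] at hD
    have hE : ∑ w ∈ cov M, cdIn G c U w ≤ (cov M).card * (3 * k) := by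
      have := Finset.sum_le_sum (fun w (hw : w ∈ cov M) => hmax w (hSU hw))
      simpa using this
    have hF := Finset.sum_sdiff (f := cdIn G c U) hSU
    have hH := Finset.card_sdiff_add_card_eq_card hSU
    rw [hMk] at hScard
    have hk1 : 1 ≤ k := by
      have := hmax v0 hv0
      omega
    simp only [Finset.sum_const, nsmul_eq_mul] at hA hC
    rw [hScard] at hE hD hH
    zify at h hE hF hH hk1
    push_cast at hB hD hA hC
    have hn : (0:ℤ) < U.card := by exact_mod_cast hne.card_pos
    generalize (U.card : ℤ) = n at *
    generalize ((U \ cov M).card : ℤ) = r at *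
    generalize (k : ℤ) = q at *
    have e1 : 2 * q * (2 * q + 1) ≤ n - 1 := by
      have : n * (2 * q * (2 * q + 1)) ≤ n * (n - 1) := by
        nlinarith [mul_le_mul_of_nonneg_left h (by linarith : (0:ℤ) ≤ 2 * (2 * q + 1) - 1)]
      exact le_of_mul_le_mul_left this hn
    have e2 : q * n ≤ q * (6 * q - 3) := by
      have : r = n - 2 * q := by linarith
      subst this
      nlinarith
    have e3 := le_of_mul_le_mul_left e2 (by linarith)
    nlinarith [sq_nonneg (q - 1)]

lemma colorDegree_eq (G : SimpleGraph V) (c : Sym2 V → ℕ) (v : V) :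
    colorDegree G c v = cdIn G c Finset.univ v := by
  unfold colorDegree cdIn
  rw [← Set.ncard_coe_finset]
  congr 1
  ext a
  simp only [Set.mem_image, Set.mem_setOf_eq, Finset.coe_image, Finset.coe_filter,
    Finset.mem_univ, true_and]
  constructor
  · rintro ⟨e, ⟨he, hv⟩, rfl⟩
    obtain ⟨w, rfl⟩ := Sym2.mem_iff_exists.1 hv
    exact ⟨w, he, rfl⟩
  · rintro ⟨w, hw, rfl⟩
    exact ⟨s(v, w), ⟨hw, Sym2.mem_mk_left v w⟩, rfl⟩

end Helpers

/-- Remark: any edge-colored graph with average color degree at least `2k - 1`, other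
than `K̃₄`, having no rainbow matching of size `k`, contains a cycle of length 3 and a
cycle of length 4. -/
theorem counterexample_contains_C3_and_C4
    {V : Type*} [Fintype V] (k : ℕ) (hk : 1 ≤ k)
    (G : SimpleGraph V) (c : Sym2 V → ℕ)
    (havg : (2 * (k : ℚ) - 1) ≤ (∑ v, (colorDegree G c v : ℚ)) / (Fintype.card V : ℚ))
    (hK4 : ¬ IsK4Tilde G c)
    (hno : ¬ ∃ M : Finset (Sym2 V), IsRainbowMatching G c M ∧ M.card = k) :
    (∃ a b d : V, G.Adj a b ∧ G.Adj b d ∧ G.Adj d a) ∧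
    (∃ a b d e : V, a ≠ d ∧ b ≠ e ∧ G.Adj a b ∧ G.Adj b d ∧ G.Adj d e ∧ G.Adj e a) := by
  have hne : Nonempty V := by
    by_contra hcon
    rw [not_nonempty_iff] at hcon
    have : (1:ℚ) ≤ k := by exact_mod_cast hk
    simp at havg
    linarith
  have hpos : (0:ℚ) < Fintype.card V := by exact_mod_cast Fintype.card_pos
  rw [le_div_iff₀ hpos] at havg
  simp only [colorDegree_eq] at havg
  have h : 2 * k * (Finset.univ : Finset V).card ≤
      ∑ w ∈ Finset.univ, cdIn G c Finset.univ w + (Finset.univ : Finset V).card := by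
    rw [Finset.card_univ]
    have : (2 * (k:ℚ) * Fintype.card V) ≤
      ∑ w, (cdIn G c Finset.univ w : ℚ) + Fintype.card V := by linarith
    exact_mod_cast this
  constructor
  · by_contra hG
    obtain ⟨M, h1, h2, -⟩ :=
      triangle_free_case G c hG k Finset.univ (Or.inr Finset.univ_nonempty) h
    exact hno ⟨M, h1, h2⟩
  · by_contra hG
    obtain ⟨M, h1, h2, -⟩ :=
      C4_free_case G c hG k Finset.univ (Or.inr Finset.univ_nonempty) h
    exact hno ⟨M, h1, h2⟩
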